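/- Let K_n (n ≥ 3) be the complete graph with edge set E, let w : 2^E → ℝ≥0 be a monotone, normalized, nonnegative submodular function, let c : E → ℝ≥0 be an edge cost with c(S) = Σ_{e∈S} c(e), let β ∈ [0,1], and define f(S) = (1−β)·w(S) − β·c(S). Let M = max_{e ∈ E} c(e) and f'(S) = f(S) + β·|S|·M. If G is the final set of any greedy sequence for the undirected TSP independence system with objective f', then G is a tour and f(G) ≥ (1/3) · max_{T a tour} f(T) − (2/3)·β·M·n. -/

import Mathlib

/-- Degree of a vertex in an edge set. -/
def degIn {V : Type*} [DecidableEq V] (S : Finset (Sym2 V)) (v : V) : ℕ :=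
  (S.filter (fun e => v ∈ e)).card

/-- `S` is the edge set of a Hamiltonian cycle of the complete graph on `V`. -/
def IsTour {V : Type*} [DecidableEq V] (S : Finset (Sym2 V)) : Prop :=
  ∃ (v : V) (w : (SimpleGraph.fromEdgeSet (S : Set (Sym2 V))).Walk v v),
    w.IsHamiltonianCycle ∧ S = w.edges.toFinset

/-- The undirected TSP independence system on the complete graph `K_n`. -/
def TSPIndep {V : Type*} [DecidableEq V] (S : Finset (Sym2 V)) : Prop :=
  (∀ e ∈ S, ¬ e.IsDiag) ∧ (∀ v : V, degIn S v ≤ 2) ∧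
  ((SimpleGraph.fromEdgeSet (S : Set (Sym2 V))).IsAcyclic ∨ IsTour S)

def Submodular {α : Type*} [DecidableEq α] (f : Finset α → ℝ) : Prop :=
  ∀ S T : Finset α, f (S ∪ T) + f (S ∩ T) ≤ f S + f T

def MonotoneFn {α : Type*} (f : Finset α → ℝ) : Prop :=
  ∀ S T : Finset α, S ⊆ T → f S ≤ f T

structure IsGreedySeq {α : Type*} [DecidableEq α] (ℱ : Set (Finset α)) (f : Finset α → ℝ)
    (l : List α) : Prop where
  nodup : l.Nodup
  indep : ∀ t : ℕ, (l.take t).toFinset ∈ ℱ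
  greedy : ∀ (t : ℕ) (ht : t < l.length), ∀ e ∉ (l.take t).toFinset,
    insert e (l.take t).toFinset ∈ ℱ →
    f (insert e (l.take t).toFinset) - f (l.take t).toFinset ≤
      f (insert (l.get ⟨t, ht⟩) (l.take t).toFinset) - f (l.take t).toFinset
  maximal : ∀ e ∉ l.toFinset, insert e l.toFinset ∉ ℱ

open SimpleGraph

/-- In a finite acyclic graph every vertex is joined by a path to a vertex with at most one
neighbour. -/
theorem SimpleGraph.IsAcyclic.exists_isPath_to_end {V : Type*} [Finite V] {G : SimpleGraph V}
    (hG : G.IsAcyclic) (x : V) :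
    ∃ (y : V) (p : G.Walk x y), p.IsPath ∧ ∀ a, G.Adj y a → a = p.penultimate := by
  have := Fintype.ofFinite V
  have hfin : {n | ∃ (y : V) (p : G.Walk x y), p.IsPath ∧ p.length = n}.Finite :=
    (Set.finite_lt_nat (Fintype.card V)).subset fun n ⟨_, _, hp, hn⟩ ↦ hn ▸ hp.length_lt
  obtain ⟨_, ⟨y, p, hp, _⟩, hmax⟩ := hfin.exists_maximal ⟨0, x, Walk.nil, by simp⟩
  refine ⟨y, p, hp, fun a ha ↦ hG.eq_penultimate_of_adj_end hp ha ?_⟩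
  by_contra hsupp
  have := hmax ⟨a, p.concat ha, hp.concat hsupp ha, rfl⟩
  rw [Walk.length_concat] at this
  lia

/-- A path in a connected graph of maximum degree two both of whose ends have no neighbour off the
path visits every vertex. -/
theorem SimpleGraph.Connected.mem_support_of_isPath {V : Type*} [Finite V] {G : SimpleGraph V}
    (hconn : G.Connected) (hdeg : ∀ v, (G.neighborSet v).ncard ≤ 2) {u v : V} {p : G.Walk u v}
    (hp : p.IsPath) (hu : ∀ a, G.Adj u a → a ∈ p.support) (hv : ∀ a, G.Adj v a → a ∈ p.support)
    (b : V) : b ∈ p.support := by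
  by_contra hb
  obtain ⟨q⟩ := hconn.preconnected u b
  obtain ⟨d, -, hd₁, hd₂⟩ := q.exists_boundary_dart {a | a ∈ p.support} p.start_mem_support hb
  obtain ⟨i, hi, hil⟩ := Walk.mem_support_iff_exists_getVert.mp hd₁
  have hadj := d.adj
  rw [← hi] at hadj
  rcases Nat.eq_zero_or_pos i with rfl | hi0
  · exact hd₂ (hu _ (by simpa using hadj))
  rcases hil.eq_or_lt with rfl | hlt
  · exact hd₂ (hv _ (by simpa using hadj))
  have hsub : insert d.snd (p.toSubgraph.neighborSet (p.getVert i)) ⊆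
      G.neighborSet (p.getVert i) :=
    Set.insert_subset hadj (p.toSubgraph.neighborSet_subset _)
  have hnot : d.snd ∉ p.toSubgraph.neighborSet (p.getVert i) := fun h ↦
    hd₂ (p.mem_verts_toSubgraph.mp (p.toSubgraph.edge_vert h.symm))
  have h₁ := Set.ncard_le_ncard hsub (Set.toFinite _)
  rw [Set.ncard_insert_of_notMem hnot (Set.toFinite _),
    hp.ncard_neighborSet_toSubgraph_internal_eq_two hi0.ne' hlt] at h₁
  have := hdeg (p.getVert i)
  lia

section EdgeSets

variable {V : Type*} [DecidableEq V] {S : Finset (Sym2 V)}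

theorem degIn_eq_ncard_neighborSet (hS : ∀ e ∈ S, ¬ e.IsDiag) (v : V) :
    degIn S v = ((fromEdgeSet (S : Set (Sym2 V))).neighborSet v).ncard := by
  rw [degIn, ← Set.ncard_coe_finset,
    ← Set.ncard_image_of_injective _ (f := fun a ↦ s(v, a)) (fun a b h ↦ Sym2.congr_right.mp h)]
  congr 1
  ext e
  constructor
  · intro he
    obtain ⟨heS, hv⟩ := Finset.mem_filter.mp (Finset.mem_coe.mp he)
    obtain ⟨a, rfl⟩ := Sym2.mem_iff_exists.mp hv
    exact ⟨a, by simpa using ⟨heS, by simpa using hS _ heS⟩, rfl⟩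
  · rintro ⟨a, ha, rfl⟩
    have := ((fromEdgeSet_adj _).mp ha).1
    simpa using this

theorem degIn_mono {T : Finset (Sym2 V)} (h : S ⊆ T) (v : V) : degIn S v ≤ degIn T v :=
  Finset.card_le_card (Finset.filter_subset_filter _ h)

theorem degIn_insert {e : Sym2 V} (he : e ∉ S) (v : V) :
    degIn (insert e S) v = degIn S v + if v ∈ e then 1 else 0 := by
  unfold degIn
  rw [Finset.filter_insert]
  split_ifs with h
  · rw [Finset.card_insert_of_notMem (by simp [he])]
  · rfl

theorem IsTour.not_isDiag (h : IsTour S) {e : Sym2 V} (he : e ∈ S) : ¬ e.IsDiag := by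
  obtain ⟨v, w, -, hS⟩ := h
  have := w.edges_subset_edgeSet (List.mem_toFinset.mp (hS ▸ he))
  exact not_isDiag_of_mem_edgeSet _ this

theorem IsTour.degIn_eq_two (h : IsTour S) (v : V) : degIn S v = 2 := by
  rw [degIn_eq_ncard_neighborSet fun e ↦ h.not_isDiag]
  obtain ⟨u, w, hw, hS⟩ := h
  rw [← hw.isCycle.ncard_neighborSet_toSubgraph_eq_two (hw.mem_support v)]
  congr 1
  ext a
  rw [mem_neighborSet, Subgraph.mem_neighborSet, Walk.adj_toSubgraph_iff_mem_edges]
  refine ⟨fun ha ↦ ?_, w.adj_of_mem_edges⟩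
  have := ((fromEdgeSet_adj _).mp ha).1
  exact List.mem_toFinset.mp (hS ▸ Finset.mem_coe.mp this)

theorem isAcyclic_insert_of_not_reachable {u v : V}
    (hS : (fromEdgeSet (S : Set (Sym2 V))).IsAcyclic)
    (huv : ¬ (fromEdgeSet (S : Set (Sym2 V))).Reachable u v) :
    (fromEdgeSet ((insert s(u, v) S : Finset (Sym2 V)) : Set (Sym2 V))).IsAcyclic := by
  convert hS.sup_edge_of_not_reachable huv using 1
  rw [edge, ← fromEdgeSet_union, Finset.coe_insert, Set.insert_eq, Set.union_comm]

theorem degIn_insert_le_two {u v : V} (hS : ∀ a, degIn S a ≤ 2) (hu : degIn S u ≤ 1)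
    (hv : degIn S v ≤ 1) (huv : s(u, v) ∉ S) (a : V) : degIn (insert s(u, v) S) a ≤ 2 := by
  rw [degIn_insert huv]
  have := hS a
  split_ifs with h
  · rcases Sym2.mem_iff.mp h with rfl | rfl <;> lia
  · lia

theorem not_isDiag_insert {u v : V} (hS : ∀ e ∈ S, ¬ e.IsDiag) (huv : u ≠ v) :
    ∀ e ∈ insert s(u, v) S, ¬ e.IsDiag := by
  simpa [huv] using hS

/-- Closing up a spanning path gives a tour. -/
theorem isTour_insert_of_isPath [Fintype V] (hn : 3 ≤ Fintype.card V)
    (hdiag : ∀ e ∈ S, ¬ e.IsDiag) (htree : (fromEdgeSet (S : Set (Sym2 V))).IsTree) {u v : V}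
    {p : (fromEdgeSet (S : Set (Sym2 V))).Walk u v} (hp : p.IsPath) (hall : ∀ b, b ∈ p.support) :
    u ≠ v ∧ s(u, v) ∉ S ∧ IsTour (insert s(u, v) S) := by
  have hlen := (hp.isHamiltonian_of_mem hall).length_eq
  have huv : u ≠ v := by
    rintro rfl
    have := (Walk.isPath_iff_nil.mp hp).length_eq_zero
    lia
  have hnot : s(u, v) ∉ S := fun h ↦ by
    have hadj : (fromEdgeSet (S : Set (Sym2 V))).Adj u v := (fromEdgeSet_adj _).mpr ⟨h, huv⟩
    have hsnd := htree.isAcyclic.eq_snd_of_adj_start hp hadj p.end_mem_support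
    have : 1 = p.length := hp.getVert_injOn (by simp; lia) (by simp)
      (hsnd.symm.trans p.getVert_length.symm)
    lia
  have hpS : p.edges.toFinset = S := by
    apply Finset.eq_of_subset_of_card_le
    · intro e he
      have := p.edges_subset_edgeSet (List.mem_toFinset.mp he)
      rw [edgeSet_fromEdgeSet] at this
      exact this.1
    · have h₁ := (isTree_iff_connected_and_card.mp htree).2
      have h₂ : (fromEdgeSet (S : Set (Sym2 V))).edgeSet = S := by
        rw [edgeSet_fromEdgeSet]
        ext e
        simpa using hdiag e
      rw [h₂, Nat.card_eq_fintype_card (α := V), Nat.card_coe_set_eq, Set.ncard_coe_finset] at h₁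
      rw [List.toFinset_card_of_nodup hp.isTrail.edges_nodup, Walk.length_edges]
      lia
  refine ⟨huv, hnot, v, ?_⟩
  have hle : fromEdgeSet (S : Set (Sym2 V)) ≤
      fromEdgeSet ((insert s(u, v) S : Finset (Sym2 V)) : Set (Sym2 V)) :=
    fromEdgeSet_mono (by simp)
  have hadj : (fromEdgeSet ((insert s(u, v) S : Finset (Sym2 V)) : Set (Sym2 V))).Adj v u :=
    (fromEdgeSet_adj _).mpr ⟨by simp [Sym2.eq_swap], huv.symm⟩
  have hedges : (p.mapLe hle).edges = p.edges := by simp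
  refine ⟨Walk.cons hadj (p.mapLe hle), ?_, ?_⟩
  · rw [Walk.isHamiltonianCycle_iff_isCycle_and_length_eq, Walk.cons_isCycle_iff, hedges]
    refine ⟨⟨hp.mapLe hle, fun h ↦ hnot ?_⟩, ?_⟩
    · rw [Sym2.eq_swap, ← hpS]
      exact List.mem_toFinset.mpr h
    · simp only [Walk.length_cons, Walk.length_map]
      lia
  · rw [Walk.edges_cons, hedges, List.toFinset_cons, hpS, Sym2.eq_swap]

/-- A forest of maximum degree two can be enlarged inside the TSP independence system. -/
theorem exists_tspIndep_insert [Fintype V] (hn : 3 ≤ Fintype.card V)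
    (hdiag : ∀ e ∈ S, ¬ e.IsDiag) (hdeg : ∀ v, degIn S v ≤ 2)
    (hacyc : (fromEdgeSet (S : Set (Sym2 V))).IsAcyclic) :
    ∃ e ∉ S, TSPIndep (insert e S) := by
  have hend : ∀ {x y : V} {p : (fromEdgeSet (S : Set (Sym2 V))).Walk x y},
      (∀ a, (fromEdgeSet (S : Set (Sym2 V))).Adj y a → a = p.penultimate) →
      degIn S y ≤ 1 := fun h ↦ by
    rw [degIn_eq_ncard_neighborSet hdiag, Set.ncard_le_one (Set.toFinite _)]
    exact fun a ha b hb ↦ (h a ha).trans (h b hb).symm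
  by_cases hconn : (fromEdgeSet (S : Set (Sym2 V))).Preconnected
  · have : Nonempty V := Fintype.card_pos_iff.mp (by lia)
    obtain ⟨x⟩ := id this
    obtain ⟨u, q, hq, hu⟩ := hacyc.exists_isPath_to_end x
    obtain ⟨v, p, hp, hv⟩ := hacyc.exists_isPath_to_end u
    have hconn' : (fromEdgeSet (S : Set (Sym2 V))).Connected := ⟨hconn⟩
    have hv' : ∀ a, (fromEdgeSet (S : Set (Sym2 V))).Adj v a → a ∈ p.support := fun a ha ↦
      hv a ha ▸ p.getVert_mem_support _
    have hall := hconn'.mem_support_of_isPath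
      (fun a ↦ (degIn_eq_ncard_neighborSet hdiag a).symm.trans_le (hdeg a)) hp (fun a ha ↦ ?_) hv'
    · obtain ⟨huv, hnot, htour⟩ := isTour_insert_of_isPath hn hdiag ⟨hconn', hacyc⟩ hp hall
      exact ⟨s(u, v), hnot, not_isDiag_insert hdiag huv,
        degIn_insert_le_two hdeg (hend hu) (hend hv) hnot, Or.inr htour⟩
    · by_cases hnil : p.Nil
      · obtain rfl := hnil.eq
        exact hv' a ha
      · rw [(hu a ha).trans (hu _ (p.adj_snd hnil)).symm]
        exact p.getVert_mem_support _
  · simp only [Preconnected, not_forall] at hconn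
    obtain ⟨x, x', hx⟩ := hconn
    obtain ⟨u, q, hq, hu⟩ := hacyc.exists_isPath_to_end x
    obtain ⟨v, p, hp, hv⟩ := hacyc.exists_isPath_to_end x'
    have huv : ¬ (fromEdgeSet (S : Set (Sym2 V))).Reachable u v := fun h ↦
      hx ((q.reachable.trans h).trans p.reachable.symm)
    have hne : u ≠ v := fun h ↦ huv (h ▸ Reachable.refl _)
    have hnot : s(u, v) ∉ S := fun h ↦ huv (Adj.reachable ((fromEdgeSet_adj _).mpr ⟨h, hne⟩))
    exact ⟨s(u, v), hnot, not_isDiag_insert hdiag hne,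
      degIn_insert_le_two hdeg (hend hu) (hend hv) hnot,
      Or.inl (isAcyclic_insert_of_not_reachable hacyc huv)⟩

/-- An edge whose ends have total degree at most one can be added to an independent set. -/
theorem TSPIndep.insert_of_degIn_add_le_one {u v : V} (hS : TSPIndep S) (huv : u ≠ v)
    (h : degIn S u + degIn S v ≤ 1) : s(u, v) ∉ S ∧ TSPIndep (insert s(u, v) S) := by
  wlog hu : degIn S u = 0 generalizing u v
  · rw [Sym2.eq_swap]
    exact this huv.symm (by lia) (by lia)
  obtain ⟨hdiag, hdeg, hacyc | htour⟩ := hS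
  swap
  · have := htour.degIn_eq_two u
    lia
  have hnot : s(u, v) ∉ S := fun hmem ↦ by
    simp only [degIn, Finset.card_eq_zero, Finset.filter_eq_empty_iff] at hu
    exact hu hmem (by simp)
  refine ⟨hnot, not_isDiag_insert hdiag huv,
    degIn_insert_le_two hdeg (by lia) (by lia) hnot,
    Or.inl (isAcyclic_insert_of_not_reachable hacyc fun ⟨p⟩ ↦ ?_)⟩
  have hadj := p.adj_snd (Walk.not_nil_of_ne huv)
  simp only [degIn, Finset.card_eq_zero, Finset.filter_eq_empty_iff] at hu
  exact hu (Finset.mem_coe.mp ((fromEdgeSet_adj _).mp hadj).1) (by simp)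

theorem TSPIndep.isAcyclic_of_insert {e : Sym2 V} (hS : TSPIndep S)
    (he : e ∉ S) (hins : TSPIndep (insert e S)) :
    (fromEdgeSet (S : Set (Sym2 V))).IsAcyclic := by
  refine hS.2.2.resolve_right fun htour ↦ ?_
  obtain ⟨v, hv⟩ : ∃ v, v ∈ e := ⟨_, e.out_fst_mem⟩
  have := hins.2.1 v
  rw [degIn_insert he, htour.degIn_eq_two, if_pos hv] at this
  lia

end EdgeSets

section SubmodularMaximization

variable {α : Type*} [DecidableEq α] {g : Finset α → ℝ}

theorem Submodular.marginal_anti (hsub : Submodular g) (hmono : MonotoneFn g) {S T : Finset α}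
    (h : S ⊆ T) (e : α) : g (insert e T) - g T ≤ g (insert e S) - g S := by
  by_cases he : e ∈ T
  · rw [Finset.insert_eq_of_mem he, sub_self, sub_nonneg]
    exact hmono _ _ (Finset.subset_insert _ _)
  · have := hsub (insert e S) T
    rw [Finset.insert_union, Finset.union_eq_right.mpr h, Finset.insert_inter_of_notMem he,
      Finset.inter_eq_left.mpr h] at this
    linarith

theorem Submodular.union_le (hsub : Submodular g) (hmono : MonotoneFn g) (S T : Finset α) :
    g (S ∪ T) ≤ g S + ∑ e ∈ T, (g (insert e S) - g S) := by
  induction T using Finset.induction_on with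
  | empty => simp
  | insert e T he ih =>
    rw [Finset.sum_insert he, Finset.union_insert]
    have := hsub.marginal_anti hmono (Finset.subset_union_left (s₁ := S) (s₂ := T)) e
    linarith

/-- Changing the objective outside the independence system does not affect greediness. -/
theorem IsGreedySeq.congr {ℱ : Set (Finset α)} {f : Finset α → ℝ} {l : List α}
    (h : IsGreedySeq ℱ f l) (hfg : ∀ S ∈ ℱ, f S = g S) : IsGreedySeq ℱ g l where
  nodup := h.nodup
  indep := h.indep
  greedy t ht e he hmem := by
    have hnext : insert (l.get ⟨t, ht⟩) (l.take t).toFinset ∈ ℱ := by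
      have := h.indep (t + 1)
      rwa [List.take_succ_eq_append_getElem ht, List.toFinset_append, Finset.union_comm] at this
    have := h.greedy t ht e he hmem
    rwa [hfg _ hmem, hfg _ hnext, hfg _ (h.indep t)] at this
  maximal := h.maximal

end SubmodularMaximization

/-- If a value `x` is dominated by the nonincreasing gains `δ t` for as long as the load `K t` is
at most one, then twice `x` is dominated by the gains weighted by the load increments. -/
theorem two_mul_le_sum_gain_mul_load {δ : ℕ → ℝ} {K : ℕ → ℕ} {m : ℕ} {x : ℝ}
    (hδ0 : ∀ i, 0 ≤ δ i) (hδ : ∀ i j, i ≤ j → j < m → δ j ≤ δ i) (hK0 : K 0 = 0)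
    (hK : Monotone K) (hKm : 2 ≤ K m) (hx : ∀ t < m, K t ≤ 1 → x ≤ δ t) :
    2 * x ≤ ∑ i ∈ Finset.range m, δ i * ((K (i + 1) : ℝ) - K i) := by
  have hex : ∃ t, 2 ≤ K t := ⟨m, hKm⟩
  obtain ⟨t, ht⟩ : ∃ t, Nat.find hex = t + 1 := Nat.exists_eq_succ_of_ne_zero fun h ↦ by
    have := Nat.find_spec hex
    rw [h] at this
    lia
  have htm : t + 1 ≤ m := ht ▸ Nat.find_min' hex hKm
  have hlow : K t ≤ 1 := by
    have := Nat.find_min hex (m := t) (by lia)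
    lia
  have hhigh : 2 ≤ K (t + 1) := ht ▸ Nat.find_spec hex
  have hincr : ∀ i, (0 : ℝ) ≤ (K (i + 1) : ℝ) - K i := fun i ↦
    sub_nonneg.mpr (Nat.cast_le.mpr (hK i.le_succ))
  calc 2 * x ≤ 2 * δ t := by linarith [hx t htm hlow]
    _ ≤ K (t + 1) * δ t := by
        have : (2 : ℝ) ≤ K (t + 1) := by exact_mod_cast hhigh
        exact mul_le_mul_of_nonneg_right this (hδ0 t)
    _ = ∑ i ∈ Finset.range (t + 1), δ t * ((K (i + 1) : ℝ) - K i) := by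
        rw [← Finset.mul_sum, Finset.sum_range_sub (fun i ↦ (K i : ℝ)), hK0]
        simp [mul_comm]
    _ ≤ ∑ i ∈ Finset.range (t + 1), δ i * ((K (i + 1) : ℝ) - K i) :=
        Finset.sum_le_sum fun i hi ↦ mul_le_mul_of_nonneg_right
          (hδ i t (Nat.lt_succ_iff.mp (Finset.mem_range.mp hi)) htm) (hincr i)
    _ ≤ _ := Finset.sum_le_sum_of_subset_of_nonneg (Finset.range_mono htm)
        fun i _ _ ↦ mul_nonneg (hδ0 i) (hincr i)

section Greedy

variable {V : Type*} [Fintype V] [DecidableEq V]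

theorem sum_sum_toFinset_eq_sum_degIn_mul (T : Finset (Sym2 V)) (h : V → ℕ) :
    ∑ e ∈ T, ∑ v ∈ e.toFinset, h v = ∑ v, degIn T v * h v := by
  have : ∀ e : Sym2 V, ∑ v ∈ e.toFinset, h v = ∑ v, if v ∈ e then h v else 0 := fun e ↦ by
    rw [← Finset.sum_filter]
    exact Finset.sum_congr (by ext; simp) fun _ _ ↦ rfl
  simp_rw [this]
  rw [Finset.sum_comm]
  refine Finset.sum_congr rfl fun v _ ↦ ?_
  rw [← Finset.sum_filter, Finset.sum_const, smul_eq_mul, degIn]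

theorem sum_degIn {S : Finset (Sym2 V)} (hS : ∀ e ∈ S, ¬ e.IsDiag) :
    ∑ v, degIn S v = 2 * S.card := by
  have := sum_sum_toFinset_eq_sum_degIn_mul S fun _ ↦ 1
  simp only [mul_one, Finset.sum_const, smul_eq_mul] at this
  rw [← this, Finset.sum_congr rfl fun e he ↦ Sym2.card_toFinset_of_not_isDiag e (hS e he)]
  simp [mul_comm]

theorem TSPIndep.isTour_of_maximal {S : Finset (Sym2 V)} (hn : 3 ≤ Fintype.card V)
    (hS : TSPIndep S) (hmax : ∀ e ∉ S, ¬ TSPIndep (insert e S)) : IsTour S := by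
  refine hS.2.2.resolve_left fun hacyc ↦ ?_
  obtain ⟨e, he, hins⟩ := exists_tspIndep_insert hn hS.1 hS.2.1 hacyc
  exact hmax e he hins

/-- The greedy algorithm for a monotone submodular objective returns a tour whose value is at
least one third of that of any other tour. -/
theorem IsGreedySeq.isTour_and_le_three_mul {g : Finset (Sym2 V) → ℝ} {l : List (Sym2 V)}
    (hn : 3 ≤ Fintype.card V) (hsub : Submodular g) (hmono : MonotoneFn g) (hnorm : g ∅ = 0)
    (hl : IsGreedySeq {S | TSPIndep S} g l) :
    IsTour l.toFinset ∧ ∀ T, IsTour T → g T ≤ 3 * g l.toFinset := by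
  have htour : IsTour l.toFinset := by
    refine TSPIndep.isTour_of_maximal hn ?_ hl.maximal
    simpa using hl.indep l.length
  refine ⟨htour, fun T hT ↦ ?_⟩
  set S : ℕ → Finset (Sym2 V) := fun t ↦ (l.take t).toFinset with hSdef
  have hindep : ∀ t, TSPIndep (S t) := hl.indep
  have hS0 : S 0 = ∅ := by simp [hSdef]
  have hSmono : Monotone S := fun i j hij ↦
    fun _ he ↦ List.mem_toFinset.mpr (List.take_subset_take_left l hij (List.mem_toFinset.mp he))
  have hsucc : ∀ t (ht : t < l.length), S (t + 1) = insert l[t] (S t) := fun t ht ↦ by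
    simp only [hSdef]
    rw [List.take_succ_eq_append_getElem ht, List.toFinset_append, Finset.union_comm]
    rfl
  have hnotMem : ∀ i j (hj : j < l.length), i ≤ j → l[j] ∉ S i := fun i j hj hij hmem ↦ by
    obtain ⟨k, hk, hkj⟩ := List.getElem_of_mem (List.mem_toFinset.mp hmem)
    rw [List.getElem_take] at hkj
    rw [List.length_take] at hk
    have := hl.nodup.getElem_inj_iff.mp hkj
    lia
  have hpos : l ≠ [] := by
    rintro rfl
    have : Nonempty V := Fintype.card_pos_iff.mp (by lia)
    have := htour.degIn_eq_two (Classical.arbitrary V)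
    simp [degIn] at this
  obtain ⟨m, hm⟩ : ∃ m, l.length = m + 1 :=
    Nat.exists_eq_succ_of_ne_zero (by simpa using hpos)
  have hSlast : S (m + 1) = l.toFinset := by simp [hSdef, ← hm]
  set δ : ℕ → ℝ := fun t ↦ g (S (t + 1)) - g (S t) with hδdef
  have hδ0 : ∀ t, 0 ≤ δ t := fun t ↦ sub_nonneg.mpr (hmono _ _ (hSmono t.le_succ))
  have hgreedy : ∀ t < l.length, ∀ e ∉ S t, TSPIndep (insert e (S t)) →
      g (insert e (S t)) - g (S t) ≤ δ t := fun t ht e he hins ↦ by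
    have := hl.greedy t ht e he hins
    simp only [hδdef, hsucc t ht]
    exact this
  have hδ : ∀ i j, i ≤ j → j < m → δ j ≤ δ i := fun i j hij hj ↦ by
    have hjl : j < l.length := by lia
    have hjl' : j + 1 < l.length := by lia
    have hsubset : insert l[j] (S i) ⊆ S (j + 1) := by
      rw [hsucc j hjl]
      exact Finset.insert_subset_insert _ (hSmono hij)
    have hacyc := (hindep (j + 1)).isAcyclic_of_insert (hnotMem _ _ hjl' le_rfl)
      (hsucc (j + 1) hjl' ▸ hindep (j + 1 + 1))
    have hins : TSPIndep (insert l[j] (S i)) :=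
      ⟨fun e he ↦ (hindep (j + 1)).1 e (hsubset he),
        fun v ↦ (degIn_mono hsubset v).trans ((hindep (j + 1)).2.1 v),
        Or.inl (hacyc.anti (fromEdgeSet_mono (Finset.coe_subset.mpr hsubset)))⟩
    calc δ j = g (insert l[j] (S j)) - g (S j) := by simp only [hδdef, hsucc j hjl]
      _ ≤ g (insert l[j] (S i)) - g (S i) := hsub.marginal_anti hmono (hSmono hij) _
      _ ≤ δ i := hgreedy i (by lia) _ (hnotMem i j hjl hij) hins
  set K : Sym2 V → ℕ → ℕ := fun e t ↦ ∑ v ∈ e.toFinset, degIn (S t) v with hKdef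
  have hK : ∀ u v, u ≠ v → ∀ t, K s(u, v) t = degIn (S t) u + degIn (S t) v := fun u v huv t ↦ by
    simp only [hKdef]
    rw [Sym2.toFinset_mk_eq, Finset.sum_pair huv]
  have hcharge : ∀ e ∈ T, 2 * (g (insert e (S m)) - g (S m)) ≤
      ∑ i ∈ Finset.range m, δ i * ((K e (i + 1) : ℝ) - K e i) := fun e he ↦ by
    induction e with | h u v
    have huv : u ≠ v := by simpa using hT.not_isDiag he
    refine two_mul_le_sum_gain_mul_load hδ0 hδ ?_ ?_ ?_ fun t ht hlow ↦ ?_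
    · simp [hKdef, hS0, degIn]
    · exact fun i j hij ↦ Finset.sum_le_sum fun v _ ↦ degIn_mono (hSmono hij) v
    · have hdeg : ∀ a, 1 ≤ degIn (S m) a := fun a ↦ by
        have h := htour.degIn_eq_two a
        rw [← hSlast, hsucc m (by lia), degIn_insert (hnotMem _ _ _ le_rfl)] at h
        split_ifs at h <;> lia
      rw [hK u v huv]
      have := hdeg u
      have := hdeg v
      lia
    · rw [hK u v huv] at hlow
      obtain ⟨hnot, hins⟩ := (hindep t).insert_of_degIn_add_le_one huv hlow
      exact (hsub.marginal_anti hmono (hSmono ht.le) _).trans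
        (hgreedy t (by lia) _ hnot hins)
  have hload : ∀ t ≤ m, ∑ e ∈ T, K e t = 4 * t := fun t ht ↦ by
    have hcard : (S t).card = t := by
      rw [List.toFinset_card_of_nodup (hl.nodup.sublist (List.take_sublist _ _)),
        List.length_take]
      lia
    rw [sum_sum_toFinset_eq_sum_degIn_mul,
      Finset.sum_congr rfl fun v _ ↦ by rw [hT.degIn_eq_two v], ← Finset.mul_sum,
      sum_degIn (hindep t).1, hcard]
    lia
  have hsum : 2 * ∑ e ∈ T, (g (insert e (S m)) - g (S m)) ≤ 4 * g (S m) := by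
    calc 2 * ∑ e ∈ T, (g (insert e (S m)) - g (S m))
        ≤ ∑ e ∈ T, ∑ i ∈ Finset.range m, δ i * ((K e (i + 1) : ℝ) - K e i) := by
          rw [Finset.mul_sum]
          exact Finset.sum_le_sum hcharge
      _ = ∑ i ∈ Finset.range m, δ i * 4 := by
          rw [Finset.sum_comm]
          refine Finset.sum_congr rfl fun i hi ↦ ?_
          have him := Finset.mem_range.mp hi
          rw [← Finset.mul_sum, Finset.sum_sub_distrib, ← Nat.cast_sum, ← Nat.cast_sum,
            hload _ him, hload _ him.le]
          push_cast
          ring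
      _ = 4 * g (S m) := by
          rw [← Finset.sum_mul, Finset.sum_range_sub (fun i ↦ g (S i)), hS0, hnorm]
          ring
  have hunion := hsub.union_le hmono (S m) T
  have hTle := hmono T (S m ∪ T) Finset.subset_union_right
  have hlast := hmono (S m) (S (m + 1)) (hSmono m.le_succ)
  rw [hSlast] at hlast
  linarith

end Greedy

/-- Greedy tour with edge costs: the greedy tour for the shifted objective
`f'(S) = f(S) + β|S|M` is a tour with value at least `(1/3)·OPT − (2/3)·β·M·n`. -/
theorem greedy_tour_with_costs {V : Type*} [Fintype V] [DecidableEq V]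
    (hn : 3 ≤ Fintype.card V)
    (w : Finset (Sym2 V) → ℝ)
    (hw_nonneg : ∀ S : Finset (Sym2 V), 0 ≤ w S)
    (hw_sub : Submodular w) (hw_mono : MonotoneFn w) (hw_norm : w ∅ = 0)
    (c : Sym2 V → ℝ) (hc : ∀ e : Sym2 V, ¬ e.IsDiag → 0 ≤ c e)
    (β : ℝ) (hβ0 : 0 ≤ β) (hβ1 : β ≤ 1)
    (f : Finset (Sym2 V) → ℝ)
    (hf : ∀ S : Finset (Sym2 V), f S = (1 - β) * w S - β * ∑ e ∈ S, c e)
    (M : ℝ) (hM_ub : ∀ e : Sym2 V, ¬ e.IsDiag → c e ≤ M)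
    (hM_mem : ∃ e : Sym2 V, ¬ e.IsDiag ∧ c e = M)
    (f' : Finset (Sym2 V) → ℝ)
    (hf' : ∀ S : Finset (Sym2 V), f' S = f S + β * (S.card : ℝ) * M)
    (l : List (Sym2 V)) (hgreedy : IsGreedySeq {S | TSPIndep S} f' l)
    (Tstar : Finset (Sym2 V)) (hTstar : IsTour Tstar)
    (hTmax : ∀ T' : Finset (Sym2 V), IsTour T' → f T' ≤ f Tstar) :
    IsTour l.toFinset ∧
      (1 / 3 : ℝ) * f Tstar - (2 / 3 : ℝ) * β * M * (Fintype.card V : ℝ) ≤ f l.toFinset := by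
  set g : Finset (Sym2 V) → ℝ := fun S ↦
    (1 - β) * w S + ∑ e ∈ S, if e.IsDiag then 0 else β * (M - c e) with hg
  have hweight : ∀ e : Sym2 V, 0 ≤ if e.IsDiag then 0 else β * (M - c e) := fun e ↦ by
    split_ifs with h
    · exact le_rfl
    · exact mul_nonneg hβ0 (sub_nonneg.mpr (hM_ub e h))
  have hfg : ∀ S : Finset (Sym2 V), (∀ e ∈ S, ¬ e.IsDiag) → f' S = g S := fun S hS ↦ by
    simp only [hf', hf, hg]
    rw [Finset.sum_congr rfl fun e he ↦ if_neg (hS e he), ← Finset.mul_sum,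
      Finset.sum_sub_distrib, Finset.sum_const, nsmul_eq_mul]
    ring
  have hsub : Submodular g := fun S T ↦ by
    have h₁ := mul_le_mul_of_nonneg_left (hw_sub S T) (sub_nonneg.mpr hβ1)
    have h₂ := Finset.sum_union_inter (s₁ := S) (s₂ := T)
      (f := fun e : Sym2 V ↦ if e.IsDiag then 0 else β * (M - c e))
    simp only [hg]
    linarith
  have hmono : MonotoneFn g := fun S T hST ↦
    add_le_add (mul_le_mul_of_nonneg_left (hw_mono S T hST) (sub_nonneg.mpr hβ1))
      (Finset.sum_le_sum_of_subset_of_nonneg hST fun e _ _ ↦ hweight e)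
  obtain ⟨htour, hle⟩ := (hgreedy.congr fun S hS ↦ hfg S hS.1).isTour_and_le_three_mul hn hsub
    hmono (by simp [hg, hw_norm])
  refine ⟨htour, ?_⟩
  have hcard : ∀ S : Finset (Sym2 V), IsTour S → (S.card : ℝ) = Fintype.card V := fun S hS ↦ by
    have := sum_degIn fun e ↦ hS.not_isDiag (e := e)
    simp only [hS.degIn_eq_two, Finset.sum_const, Finset.card_univ, smul_eq_mul] at this
    exact_mod_cast (by lia : S.card = Fintype.card V)
  have := hle Tstar hTstar
  rw [← hfg _ fun e ↦ hTstar.not_isDiag, ← hfg _ fun e ↦ htour.not_isDiag, hf', hf',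
    hcard _ hTstar, hcard _ htour] at this
  linarith
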